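/- arXiv:1903.08110 — 2 statements merged into one kernel-verified Lean document; each statement's English description precedes it below -/
import Mathlib

section
/- Let d ≥ 1, T ≥ 1, D > 0, L > 0, let X ⊆ ℝ^d be nonempty with ℓ∞-diameter at most D, and let f_1, …, f_T : X → ℝ each be L-Lipschitz with respect to the ℓ1 norm. Set η = 1/(L·√(125 d T)) and let μ_η be the product probability measure on ℝ^d whose coordinates are i.i.d. exponential with parameter η. Suppose x_1, …, x_T : ℝ^d → X are measurable maps such that for μ_η-almost every σ and every t, x_t(σ) exactly minimizes x ↦ Σ_{i=1}^{t−1} f_i(x) − ⟨σ, x⟩ over X. Then the expected average regret satisfies (1/T)·E_{σ∼μ_η}[ Σ_{t=1}^T f_t(x_t(σ)) − inf_{x∈X} Σ_{t=1}^T f_t(x) ] ≤ 23 · L · D · d^{3/2} / √T. -/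
open MeasureTheory

noncomputable section

/-- The exponential distribution with rate `η`: density `η * exp (-η x)` on `[0, ∞)`,
so that `P (Z ≥ s) = exp (-η s)` for `s ≥ 0`. -/
def expoMeasure (η : ℝ) : Measure ℝ :=
  volume.withDensity fun x => ENNReal.ofReal (if 0 ≤ x then η * Real.exp (-(η * x)) else 0)

instance (η : ℝ) : SigmaFinite (expoMeasure η) := by
  unfold expoMeasure; infer_instance

/-- The product probability measure on `ℝ^d` whose coordinates are i.i.d. `Exp(η)`. -/
def expoProd (d : ℕ) (η : ℝ) : Measure (Fin d → ℝ) :=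
  Measure.pi fun _ => expoMeasure η

/-- Standard inner product on `ℝ^d`. -/
def dotp {d : ℕ} (σ x : Fin d → ℝ) : ℝ := ∑ i, σ i * x i

/-- ℓ1 norm on `ℝ^d`. -/
def l1 {d : ℕ} (x : Fin d → ℝ) : ℝ := ∑ i, |x i|

lemma dotp_shift {d : ℕ} (σ z : Fin d → ℝ) (i : Fin d) (c : ℝ) :
    dotp (σ + Pi.single i c) z = dotp σ z + c * z i := by
  unfold dotp
  simp [add_mul, Finset.sum_add_distrib, Pi.single_apply]

lemma expo_prob {η : ℝ} (h : 0 < η) : IsProbabilityMeasure (expoMeasure η) := by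
  constructor
  unfold expoMeasure
  rw [withDensity_apply _ MeasurableSet.univ, Measure.restrict_univ]
  have := ProbabilityTheory.lintegral_exponentialPDF_eq_one h
  simpa only [ProbabilityTheory.exponentialPDF_eq] using this

lemma expo_dens_meas (η : ℝ) :
    Measurable (fun x : ℝ => (if 0 ≤ x then η * Real.exp (-(η * x)) else 0)) := by
  apply Measurable.ite measurableSet_Ici
  · fun_prop
  · fun_prop

lemma expo_shift {η c : ℝ} (hc : 0 ≤ c) (B : Set ℝ) (hB : MeasurableSet B) :
    expoMeasure η (B ∩ Set.Ici c) =
      ENNReal.ofReal (Real.exp (-(η * c))) * expoMeasure η ((fun x => x + c) ⁻¹' B) := by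
  have hm := (expo_dens_meas η).ennreal_ofReal
  have hB' : MeasurableSet ((fun x => x + c) ⁻¹' B) := measurable_add_const c hB
  unfold expoMeasure
  rw [withDensity_apply _ (hB.inter measurableSet_Ici), withDensity_apply _ hB',
    ← lintegral_indicator (hB.inter measurableSet_Ici), ← lintegral_indicator hB',
    ← lintegral_const_mul _ (hm.indicator hB'),
    ← lintegral_add_right_eq_self _ c]
  congr 1
  ext x
  by_cases h1 : x + c ∈ B <;> by_cases h2 : 0 ≤ x
  · have h3 : 0 ≤ x + c := by linarith
    simp only [Set.indicator, Set.mem_inter_iff, Set.mem_Ici, Set.mem_preimage, h1, h2, h3,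
      le_add_iff_nonneg_left, and_self, if_true]
    rw [← ENNReal.ofReal_mul (Real.exp_pos _).le]
    congr 1
    rw [mul_left_comm, ← Real.exp_add]
    ring_nf
  all_goals simp [Set.indicator, h1, h2]

lemma prod_shift {d : ℕ} {η c : ℝ} (hc : 0 ≤ c) (i : Fin d) :
    ENNReal.ofReal (Real.exp (-(η * c))) • (expoProd d η).map (fun σ => σ + Pi.single i c) =
      (expoProd d η).restrict
        (Set.univ.pi fun j => if j = i then Set.Ici c else Set.univ) := by
  unfold expoProd
  rw [Measure.restrict_pi_pi]
  symm
  have hsf : ∀ j : Fin d, SigmaFinite ((expoMeasure η).restrict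
    (if j = i then Set.Ici c else Set.univ)) := fun j => inferInstance
  apply Measure.pi_eq
  intro s hs
  rw [Measure.smul_apply, Measure.map_apply (measurable_add_const _)
    (MeasurableSet.univ_pi hs)]
  have hpre : (fun σ : Fin d → ℝ => σ + Pi.single i c) ⁻¹' (Set.univ.pi s) =
      Set.univ.pi (fun j => if j = i then (fun x => x + c) ⁻¹' (s j) else s j) := by
    ext σ
    simp only [Set.mem_preimage, Set.mem_pi, Set.mem_univ, true_implies]
    refine forall_congr' fun j => ?_
    by_cases h : j = i
    · subst h; simp
    · simp [h]
  rw [hpre, Measure.pi_pi, ← Finset.mul_prod_erase _ _ (Finset.mem_univ i),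
    ← Finset.mul_prod_erase Finset.univ (fun j => ((expoMeasure η).restrict
    (if j = i then Set.Ici c else Set.univ)) (s j)) (Finset.mem_univ i)]
  simp only [if_true, smul_eq_mul]
  rw [Measure.restrict_apply (hs i), expo_shift hc _ (hs i), mul_assoc]
  congr 2
  apply Finset.prod_congr rfl
  intro j hj
  have : j ≠ i := (Finset.mem_erase.mp hj).1
  simp [this]

lemma shift_le {d : ℕ} {η c : ℝ} (hc : 0 ≤ c) (i : Fin d) :
    ENNReal.ofReal (Real.exp (-(η * c))) • (expoProd d η).map (fun σ => σ + Pi.single i c) ≤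
      expoProd d η := by
  rw [prod_shift hc]; exact Measure.restrict_le_self

lemma shift_ae {d : ℕ} {η c : ℝ} (hc : 0 ≤ c) (i : Fin d) (P : (Fin d → ℝ) → Prop)
    (h : ∀ᵐ σ ∂(expoProd d η), P σ) :
    ∀ᵐ σ ∂(expoProd d η), P (σ + Pi.single i c) := by
  have h1 : ∀ᵐ σ ∂(ENNReal.ofReal (Real.exp (-(η * c))) •
      (expoProd d η).map (fun σ => σ + Pi.single i c)), P σ :=
    Filter.Eventually.filter_mono (ae_mono (shift_le hc i)) h
  have h2 : ∀ᵐ σ ∂((expoProd d η).map (fun σ => σ + Pi.single i c)), P σ := by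
    rwa [Measure.ae_ennreal_smul_measure_iff] at h1
    simp [Real.exp_pos]
  exact ae_of_ae_map (measurable_add_const _).aemeasurable h2

lemma shift_int {d : ℕ} {η c : ℝ} (hc : 0 ≤ c) (i : Fin d) (g : (Fin d → ℝ) → ℝ)
    (hg : Measurable g) (hgi : Integrable g (expoProd d η))
    (h0 : ∀ᵐ σ ∂(expoProd d η), 0 ≤ g σ) :
    Real.exp (-(η * c)) * ∫ σ, g (σ + Pi.single i c) ∂(expoProd d η) ≤
      ∫ σ, g σ ∂(expoProd d η) := by
  have := integral_mono_measure (shift_le (η := η) hc i) h0 hgi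
  rw [integral_smul_measure, integral_map (measurable_add_const _).aemeasurable
    hg.aestronglyMeasurable, ENNReal.toReal_ofReal (Real.exp_pos _).le] at this
  exact this

lemma expo_mean {η : ℝ} (h : 0 < η) :
    Integrable (fun x : ℝ => |x|) (expoMeasure η) ∧ ∫ x, |x| ∂(expoMeasure η) = 1 / η := by
  have key : ∫ x, |x| ∂(expoMeasure η) = 1 / η := by
    unfold expoMeasure
    rw [integral_withDensity_eq_integral_toReal_smul (expo_dens_meas η).ennreal_ofReal
      (by simp)]
    have e1 : ∀ x : ℝ, (ENNReal.ofReal (if 0 ≤ x then η * Real.exp (-(η * x)) else 0)).toReal •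
        |x| = (Set.Ici (0:ℝ)).indicator
          (fun x => η * (x ^ ((2:ℝ) - 1) * Real.exp (-(η * x)))) x := by
      intro x
      by_cases hx : 0 ≤ x
      · have h3 : 0 ≤ η * Real.exp (-(η * x)) := by positivity
        simp only [hx, if_true, Set.indicator, Set.mem_Ici, ENNReal.toReal_ofReal h3,
          smul_eq_mul, abs_of_nonneg hx]
        norm_num
        ring
      · simp [hx, Set.indicator]
    simp_rw [e1]
    rw [integral_indicator measurableSet_Ici, integral_Ici_eq_integral_Ioi,
      integral_const_mul, Real.integral_rpow_mul_exp_neg_mul_Ioi (by norm_num) h]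
    have : Real.Gamma 2 = 1 := by simpa using Real.Gamma_nat_eq_factorial 1
    rw [this]
    norm_num
    field_simp
  refine ⟨?_, key⟩
  by_contra hn
  rw [integral_undef hn] at key
  have : 0 < 1 / η := by positivity
  linarith

lemma prod_mean {d : ℕ} {η : ℝ} (h : 0 < η) (i : Fin d) :
    Integrable (fun σ : Fin d → ℝ => |σ i|) (expoProd d η) ∧
      ∫ σ, |σ i| ∂(expoProd d η) = 1 / η := by
  have := expo_prob h
  have mp : MeasurePreserving (Function.eval i) (expoProd d η) (expoMeasure η) :=
    measurePreserving_eval (fun _ : Fin d => expoMeasure η) i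
  obtain ⟨h1, h2⟩ := expo_mean h
  constructor
  · exact mp.integrable_comp_of_integrable h1
  · rw [← h2, ← mp.map_eq, integral_map mp.aemeasurable
      (continuous_abs.measurable).aestronglyMeasurable]

lemma l1_nonneg {d : ℕ} (x : Fin d → ℝ) : 0 ≤ l1 x :=
  Finset.sum_nonneg fun _ _ => abs_nonneg _

lemma l1_le {d : ℕ} {D : ℝ} (x y : Fin d → ℝ) (h : ∀ i, |x i - y i| ≤ D) :
    l1 (x - y) ≤ d * D := by
  unfold l1
  calc _ ≤ ∑ i : Fin d, D := Finset.sum_le_sum fun i _ => h i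
    _ = _ := by simp

/-- Be-the-leader. -/
lemma btl {d T : ℕ} (X : Set (Fin d → ℝ)) (f : ℕ → (Fin d → ℝ) → ℝ) (σ : Fin d → ℝ)
    (x : ℕ → (Fin d → ℝ))
    (hmin : ∀ t < T, x t ∈ X ∧ ∀ y ∈ X,
        (∑ i ∈ Finset.range t, f i (x t)) - dotp σ (x t) ≤
          (∑ i ∈ Finset.range t, f i y) - dotp σ y) (n : ℕ) (hn : n < T) :
    ∀ y ∈ X, (∑ t ∈ Finset.range n, f t (x (t+1))) - dotp σ (x 0) ≤
      (∑ t ∈ Finset.range n, f t y) - dotp σ y := by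
  induction n with
  | zero => intro y hy; simpa using (hmin 0 hn).2 y hy
  | succ n ih =>
    intro y hy
    have h1 := ih (by omega) (x (n+1)) (hmin (n+1) hn).1
    have h2 := (hmin (n+1) hn).2 y hy
    rw [Finset.sum_range_succ] at h2 ⊢
    linarith

/-- Pointwise stability. -/
lemma stab_pt {d : ℕ} (F f : (Fin d → ℝ) → ℝ) (σ a b a' b' : Fin d → ℝ) (i : Fin d)
    (c K : ℝ) (hc : 0 < c) (hK : |f a - f b| ≤ K)
    (hab : F a - dotp σ a ≤ F b - dotp σ b)
    (haa' : F a - dotp σ a ≤ F a' - dotp σ a')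
    (hba : F b + f b - dotp σ b ≤ F a + f a - dotp σ a)
    (hbb' : F b + f b - dotp σ b ≤ F b' + f b' - dotp σ b')
    (ha'a : F a' - dotp (σ + Pi.single i c) a' ≤ F a - dotp (σ + Pi.single i c) a)
    (ha'b : F a' - dotp (σ + Pi.single i c) a' ≤ F b - dotp (σ + Pi.single i c) b)
    (hb'a : F b' + f b' - dotp (σ + Pi.single i c) b' ≤
      F a + f a - dotp (σ + Pi.single i c) a)
    (hb'b : F b' + f b' - dotp (σ + Pi.single i c) b' ≤
      F b + f b - dotp (σ + Pi.single i c) b) :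
    max (a i) (b i) - K / c ≤ min (a' i) (b' i) := by
  simp only [dotp_shift] at *
  obtain ⟨h1, h2⟩ := abs_le.mp hK
  have hK0 : 0 ≤ K := (abs_nonneg _).trans hK
  rw [sub_le_iff_le_add]
  have key : ∀ u v : ℝ, c * u ≤ c * v + K → u ≤ v + K / c := by
    intro u v h
    have : u ≤ (c * v + K) / c := by rw [le_div_iff₀ hc]; linarith
    rwa [add_div, mul_div_cancel_left₀ _ hc.ne'] at this
  rcases min_choice (a' i) (b' i) with h | h <;> rw [h] <;> apply max_le <;> apply key <;>
    linarith

lemma stab_pt2 {d : ℕ} (X : Set (Fin d → ℝ)) (f : ℕ → (Fin d → ℝ) → ℝ) (σ : Fin d → ℝ)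
    (i : Fin d) (c L : ℝ) (hc : 0 < c) (t : ℕ) (a b a' b' : Fin d → ℝ)
    (hf : ∀ x ∈ X, ∀ y ∈ X, |f t x - f t y| ≤ L * l1 (x - y))
    (A : a ∈ X ∧ ∀ y ∈ X, (∑ i ∈ Finset.range t, f i a) - dotp σ a ≤
      (∑ i ∈ Finset.range t, f i y) - dotp σ y)
    (B : b ∈ X ∧ ∀ y ∈ X, (∑ i ∈ Finset.range (t+1), f i b) - dotp σ b ≤
      (∑ i ∈ Finset.range (t+1), f i y) - dotp σ y)
    (A' : a' ∈ X ∧ ∀ y ∈ X,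
      (∑ i ∈ Finset.range t, f i a') - dotp (σ + Pi.single i c) a' ≤
      (∑ i ∈ Finset.range t, f i y) - dotp (σ + Pi.single i c) y)
    (B' : b' ∈ X ∧ ∀ y ∈ X,
      (∑ i ∈ Finset.range (t+1), f i b') - dotp (σ + Pi.single i c) b' ≤
      (∑ i ∈ Finset.range (t+1), f i y) - dotp (σ + Pi.single i c) y) :
    max (a i) (b i) - L * l1 (a - b) / c ≤ min (a' i) (b' i) := by
  simp only [Finset.sum_range_succ] at B B'
  exact stab_pt (fun y => ∑ i ∈ Finset.range t, f i y) (f t) σ a b a' b' i c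
    (L * l1 (a - b)) hc (hf _ A.1 _ B.1)
    (A.2 _ B.1) (A.2 _ A'.1) (B.2 _ A.1) (B.2 _ B'.1)
    (A'.2 _ A.1) (A'.2 _ B.1) (B'.2 _ A.1) (B'.2 _ B.1)

/-- Stability in expectation. -/
lemma stab {d T : ℕ} (hd : 1 ≤ d)
    (D L : ℝ) (hD : 0 < D) (hL : 0 < L)
    (X : Set (Fin d → ℝ)) (hX : X.Nonempty)
    (hdiam : ∀ x ∈ X, ∀ y ∈ X, ∀ i, |x i - y i| ≤ D)
    (f : ℕ → (Fin d → ℝ) → ℝ)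
    (hf : ∀ t < T, ∀ x ∈ X, ∀ y ∈ X, |f t x - f t y| ≤ L * l1 (x - y))
    (η : ℝ) (hη : 0 < η)
    (x : ℕ → (Fin d → ℝ) → (Fin d → ℝ))
    (hmeas : ∀ t < T, Measurable (x t))
    (hmin : ∀ᵐ σ ∂(expoProd d η), ∀ t < T, x t σ ∈ X ∧
      ∀ y ∈ X,
        (∑ i ∈ Finset.range t, f i (x t σ)) - dotp σ (x t σ) ≤
          (∑ i ∈ Finset.range t, f i y) - dotp σ y) (t : ℕ) (ht : t + 1 < T) :
    Integrable (fun σ => l1 (x t σ - x (t+1) σ)) (expoProd d η) ∧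
    ∫ σ, l1 (x t σ - x (t+1) σ) ∂(expoProd d η) ≤ 4 * η * L * d ^ 2 * D := by
  have hp := expo_prob hη
  have hP : IsProbabilityMeasure (expoProd d η) := by unfold expoProd; infer_instance
  have htT : t < T := by omega
  have hd0 : (0:ℝ) < d := by exact_mod_cast hd
  have ma : ∀ i, Measurable fun σ => x t σ i := fun i =>
    (measurable_pi_apply i).comp (hmeas t htT)
  have mb : ∀ i, Measurable fun σ => x (t+1) σ i := fun i =>
    (measurable_pi_apply i).comp (hmeas (t+1) ht)
  have hint : ∀ i, Integrable (fun σ => |x t σ i - x (t+1) σ i|) (expoProd d η) := by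
    intro i
    refine Integrable.of_bound (C := D) ((ma i).sub (mb i)).abs.aestronglyMeasurable ?_
    filter_upwards [hmin] with σ h
    rw [Real.norm_eq_abs, abs_abs]
    exact hdiam _ (h t htT).1 _ (h (t+1) ht).1 i
  have hl1 : Integrable (fun σ => l1 (x t σ - x (t+1) σ)) (expoProd d η) := by
    unfold l1
    exact integrable_finsetSum _ fun i _ => hint i
  refine ⟨hl1, ?_⟩
  set S := ∫ σ, l1 (x t σ - x (t+1) σ) ∂(expoProd d η) with hS
  set c : ℝ := 2 * L * d with hc
  have hc0 : 0 < c := by positivity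
  set e := Real.exp (-(η * c)) with he
  have he0 : 0 < e := Real.exp_pos _
  have he1 : e ≤ 1 := Real.exp_le_one_iff.mpr (by have : 0 < η * c := by positivity
                                                  linarith)
  have he2 : 1 - e ≤ η * c := by have := Real.add_one_le_exp (-(η * c)); linarith
  have coord : ∀ i, ∫ σ, |x t σ i - x (t+1) σ i| ∂(expoProd d η) ≤
      η * c * D + (1 / (2 * d)) * S := by
    intro i
    obtain ⟨m, hm⟩ : ∃ m : ℝ, ∀ z ∈ X, m ≤ z i ∧ z i ≤ m + D := by
      obtain ⟨z0, hz0⟩ := hX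
      refine ⟨sInf ((fun z => z i) '' X), fun z hz => ⟨csInf_le ?_ ⟨z, hz, rfl⟩, ?_⟩⟩
      · refine ⟨z0 i - D, ?_⟩
        rintro _ ⟨w, hw, rfl⟩
        have := (abs_le.mp (hdiam z0 hz0 w hw i)).2
        simp only; linarith
      · rw [← sub_le_iff_le_add]
        apply le_csInf (Set.Nonempty.image _ ⟨z0, hz0⟩)
        rintro _ ⟨w, hw, rfl⟩
        have := (abs_le.mp (hdiam z hz w hw i)).2
        simp only; linarith
    set g : (Fin d → ℝ) → ℝ := fun σ => min (x t σ i) (x (t+1) σ i) - m with hg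
    set G : (Fin d → ℝ) → ℝ := fun σ => max (x t σ i) (x (t+1) σ i) - m with hG
    have mg : Measurable g := ((ma i).min (mb i)).sub_const m
    have mG : Measurable G := ((ma i).max (mb i)).sub_const m
    have hbd : ∀ᵐ σ ∂(expoProd d η), (0 ≤ g σ ∧ g σ ≤ D) ∧ (0 ≤ G σ ∧ G σ ≤ D) := by
      filter_upwards [hmin] with σ h
      obtain ⟨p1, p2⟩ := hm _ (h t htT).1
      obtain ⟨q1, q2⟩ := hm _ (h (t+1) ht).1
      simp only [hg, hG]
      refine ⟨⟨?_, ?_⟩, ?_, ?_⟩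
      · rw [sub_nonneg]; exact le_min p1 q1
      · have := min_le_left (x t σ i) (x (t+1) σ i); linarith
      · rw [sub_nonneg]; exact p1.trans (le_max_left _ _)
      · have := max_le p2 q2; linarith
    have ig : Integrable g (expoProd d η) := by
      refine Integrable.of_bound (C := D) mg.aestronglyMeasurable ?_
      filter_upwards [hbd] with σ h
      rw [Real.norm_eq_abs, abs_of_nonneg h.1.1]; exact h.1.2
    have iG : Integrable G (expoProd d η) := by
      refine Integrable.of_bound (C := D) mG.aestronglyMeasurable ?_
      filter_upwards [hbd] with σ h
      rw [Real.norm_eq_abs, abs_of_nonneg h.2.1]; exact h.2.2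
    have igs : Integrable (fun σ => g (σ + Pi.single i c)) (expoProd d η) := by
      refine Integrable.of_bound (C := D)
        (mg.comp (measurable_add_const _)).aestronglyMeasurable ?_
      filter_upwards [shift_ae hc0.le i _ hbd] with σ h
      rw [Real.norm_eq_abs, abs_of_nonneg h.1.1]; exact h.1.2
    have h1 : Real.exp (-(η * c)) * ∫ σ, g (σ + Pi.single i c) ∂(expoProd d η) ≤
      ∫ σ, g σ ∂(expoProd d η) :=
      shift_int hc0.le i g mg ig (hbd.mono fun σ h => h.1.1)
    have h2 : ∫ σ, G σ - (1 / (2 * d)) * l1 (x t σ - x (t+1) σ) ∂(expoProd d η) ≤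
        ∫ σ, g (σ + Pi.single i c) ∂(expoProd d η) := by
      apply integral_mono_ae (iG.sub (hl1.const_mul _)) igs
      filter_upwards [hmin, shift_ae hc0.le i _ hmin] with σ h h'
      have := stab_pt2 X f σ i c L hc0 t (x t σ) (x (t+1) σ)
        (x t (σ + Pi.single i c)) (x (t+1) (σ + Pi.single i c)) (hf t htT)
        (h t htT) (h (t+1) ht) (h' t htT) (h' (t+1) ht)
      have e : L * l1 (x t σ - x (t+1) σ) / c = (1 / (2 * d)) * l1 (x t σ - x (t+1) σ) := by
        rw [hc]; field_simp
      rw [e] at this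
      simp only [hg, hG, Pi.sub_apply]
      linarith
    rw [integral_sub iG (hl1.const_mul _), integral_const_mul] at h2
    have h3 : ∫ σ, |x t σ i - x (t+1) σ i| ∂(expoProd d η) =
        ∫ σ, G σ ∂(expoProd d η) - ∫ σ, g σ ∂(expoProd d η) := by
      rw [← integral_sub iG ig]
      congr 1
      ext σ
      simp only [hg, hG]
      rw [sub_sub_sub_cancel_right, max_sub_min_eq_abs']
    have h4 : ∫ σ, G σ ∂(expoProd d η) ≤ D := by
      calc _ ≤ ∫ σ, D ∂(expoProd d η) :=
            integral_mono_ae iG (integrable_const _) (hbd.mono fun σ h => h.2.2)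
        _ = D := by simp
    have hS0 : 0 ≤ S := integral_nonneg fun σ => l1_nonneg _
    rw [h3]
    rw [← hS] at h2
    rw [← he] at h1
    have hk : 0 ≤ 1 / (2 * (d:ℝ)) * S := by positivity
    set kS := 1 / (2 * (d:ℝ)) * S
    set IG := ∫ σ, G σ ∂(expoProd d η)
    set Ig := ∫ σ, g σ ∂(expoProd d η)
    have h5 := mul_le_mul_of_nonneg_left h2 he0.le
    have h6 : (1 - e) * IG ≤ (1 - e) * D := mul_le_mul_of_nonneg_left h4 (by linarith)
    have h7 : (1 - e) * D ≤ η * c * D := mul_le_mul_of_nonneg_right he2 hD.le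
    have h8 : e * kS ≤ 1 * kS := mul_le_mul_of_nonneg_right he1 hk
    linarith
  have hsum : S = ∑ i, ∫ σ, |x t σ i - x (t+1) σ i| ∂(expoProd d η) := by
    rw [hS, ← integral_finsetSum _ fun i _ => hint i]
    rfl
  have h9 : S ≤ ∑ i : Fin d, (η * c * D + (1 / (2 * d)) * S) := by
    conv_lhs => rw [hsum]
    exact Finset.sum_le_sum fun i _ => coord i
  rw [Finset.sum_const, Finset.card_univ, Fintype.card_fin, nsmul_eq_mul] at h9
  have h10 : (d:ℝ) * (η * c * D + (1 / (2 * d)) * S) = 2 * η * L * d^2 * D + S / 2 := by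
    rw [hc]; field_simp
  linarith

/-- **Optimal `O(T^{-1/2})` regret for FTPL with an exact oracle.** Rounds are indexed
`0, …, T-1`; with perturbation parameter `η = 1/(L√(125dT))` and exact perturbed-leader
predictions, the expected average regret is at most `23 L D d^{3/2} / √T`. -/
theorem ftpl_optimal_rate (d T : ℕ) (hd : 1 ≤ d) (hT : 1 ≤ T)
    (D L : ℝ) (hD : 0 < D) (hL : 0 < L)
    (X : Set (Fin d → ℝ)) (hX : X.Nonempty)
    (hdiam : ∀ x ∈ X, ∀ y ∈ X, ∀ i, |x i - y i| ≤ D)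
    (f : ℕ → (Fin d → ℝ) → ℝ)
    (hf : ∀ t < T, ∀ x ∈ X, ∀ y ∈ X, |f t x - f t y| ≤ L * l1 (x - y))
    (η : ℝ) (hη : η = 1 / (L * Real.sqrt (125 * d * T)))
    (x : ℕ → (Fin d → ℝ) → (Fin d → ℝ))
    (hmeas : ∀ t < T, Measurable (x t))
    (hmin : ∀ᵐ σ ∂(expoProd d η), ∀ t < T, x t σ ∈ X ∧
      ∀ y ∈ X,
        (∑ i ∈ Finset.range t, f i (x t σ)) - dotp σ (x t σ) ≤
          (∑ i ∈ Finset.range t, f i y) - dotp σ y) :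
    (1 / T) * (∫ σ, ((∑ t ∈ Finset.range T, f t (x t σ)) -
          sInf ((fun y => ∑ t ∈ Finset.range T, f t y) '' X)) ∂(expoProd d η)) ≤
      23 * L * D * (d : ℝ) ^ ((3 : ℝ) / 2) / Real.sqrt T := by
  have hd0 : (1:ℝ) ≤ d := by exact_mod_cast hd
  have hT0 : (1:ℝ) ≤ T := by exact_mod_cast hT
  have hη0 : 0 < η := by rw [hη]; positivity
  have hp := expo_prob hη0
  have hP : IsProbabilityMeasure (expoProd d η) := by unfold expoProd; infer_instance
  obtain ⟨n, rfl⟩ : ∃ n, T = n + 1 := ⟨T - 1, by omega⟩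
  by_cases hI : Integrable (fun σ => ((∑ t ∈ Finset.range (n+1), f t (x t σ)) -
          sInf ((fun y => ∑ t ∈ Finset.range (n+1), f t y) '' X))) (expoProd d η)
  swap
  · rw [integral_undef hI, mul_zero]; positivity
  have st := stab hd D L hD hL X hX hdiam f hf η hη0 x hmeas hmin
  have hpm := fun i : Fin d => prod_mean hη0 i
  have i1 : Integrable (fun σ => ∑ t ∈ Finset.range n, L * l1 (x t σ - x (t+1) σ))
      (expoProd d η) := integrable_finsetSum _ fun t ht =>
        ((st t (by have := Finset.mem_range.mp ht; omega)).1.const_mul L)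
  have i2 : Integrable (fun σ : Fin d → ℝ => ∑ i, |σ i| * D) (expoProd d η) :=
    integrable_finsetSum _ fun i _ => (hpm i).1.mul_const D
  have i3 : Integrable (fun σ : Fin d → ℝ => L * (d * D)) (expoProd d η) :=
    integrable_const _
  have i12 : Integrable (fun σ => ∑ t ∈ Finset.range n, L * l1 (x t σ - x (t+1) σ) +
      ∑ i, |σ i| * D) (expoProd d η) := i1.add i2
  have B1 := integral_mono_ae hI (i12.add i3) (by
    filter_upwards [hmin] with σ h
    simp only [Pi.add_apply]
    rw [sub_le_comm]
    apply le_csInf (hX.image _)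
    rintro _ ⟨y, hy, rfl⟩
    simp only
    have b := btl X f σ (fun t => x t σ) h n (by omega) y hy
    have hl : f n (x n σ) - f n y ≤ L * (d * D) := by
      refine (le_abs_self _).trans ((hf n (by omega) _ (h n (by omega)).1 _ hy).trans ?_)
      exact mul_le_mul_of_nonneg_left (l1_le _ _ (hdiam _ (h n (by omega)).1 _ hy)) hL.le
    have hs : ∑ t ∈ Finset.range n, f t (x t σ) ≤ ∑ t ∈ Finset.range n, f t (x (t+1) σ) +
        ∑ t ∈ Finset.range n, L * l1 (x t σ - x (t+1) σ) := by
      rw [← Finset.sum_add_distrib]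
      apply Finset.sum_le_sum
      intro t ht
      have := Finset.mem_range.mp ht
      have := (abs_le.mp (hf t (by omega) _ (h t (by omega)).1 _ (h (t+1) (by omega)).1)).2
      linarith
    have hdp : dotp σ (x 0 σ) - dotp σ y ≤ ∑ i, |σ i| * D := by
      unfold dotp
      rw [← Finset.sum_sub_distrib]
      apply Finset.sum_le_sum
      intro i _
      rw [← mul_sub]
      refine (le_abs_self _).trans ?_
      rw [abs_mul]
      exact mul_le_mul_of_nonneg_left (hdiam _ (h 0 (by omega)).1 _ hy i) (abs_nonneg _)
    simp only [Finset.sum_range_succ]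
    linarith)
  simp only [Pi.add_apply] at B1
  rw [integral_add i12 i3] at B1
  rw [integral_add i1 i2, integral_finsetSum _ (fun t ht =>
        ((st t (by have := Finset.mem_range.mp ht; omega)).1.const_mul L)),
    integral_finsetSum _ (fun i _ => (hpm i).1.mul_const D)] at B1
  simp only [integral_const_mul, integral_mul_const, (hpm _).2] at B1
  have B2 : ∑ t ∈ Finset.range n, L * ∫ σ, l1 (x t σ - x (t+1) σ) ∂(expoProd d η) ≤
      n * (L * (4 * η * L * d ^ 2 * D)) := by
    calc _ ≤ ∑ t ∈ Finset.range n, L * (4 * η * L * d ^ 2 * D) :=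
          Finset.sum_le_sum fun t ht => mul_le_mul_of_nonneg_left
            (st t (by have := Finset.mem_range.mp ht; omega)).2 hL.le
      _ = _ := by simp
  simp only [Finset.sum_const, Finset.card_univ, Fintype.card_fin, nsmul_eq_mul,
    integral_const, probReal_univ, one_smul] at B1
  set I := ∫ σ, ((∑ t ∈ Finset.range (n+1), f t (x t σ)) -
          sInf ((fun y => ∑ t ∈ Finset.range (n+1), f t y) '' X)) ∂(expoProd d η) with hIdef
  have hnT : (n:ℝ) ≤ ((n+1 : ℕ) : ℝ) := by push_cast; linarith
  set τ : ℝ := ((n+1 : ℕ) : ℝ) with hτ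
  set δ : ℝ := (d:ℝ) with hδ
  obtain ⟨s, hs1, hs⟩ : ∃ s : ℝ, 1 ≤ s ∧ s^2 = δ :=
    ⟨Real.sqrt δ, Real.one_le_sqrt.mpr hd0, Real.sq_sqrt (by linarith)⟩
  obtain ⟨r, hr1, hr, hrs⟩ : ∃ r : ℝ, 1 ≤ r ∧ r^2 = τ ∧ Real.sqrt τ = r :=
    ⟨Real.sqrt τ, Real.one_le_sqrt.mpr hT0, Real.sq_sqrt (by linarith), rfl⟩
  obtain ⟨q, hq1, hq2, hqq, hqs⟩ : ∃ q : ℝ, 11 ≤ q ∧ q ≤ 12 ∧ q^2 = 125 ∧ Real.sqrt 125 = q :=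
    ⟨Real.sqrt 125, Real.le_sqrt_of_sq_le (by norm_num), by
      rw [Real.sqrt_le_left (by norm_num)]; norm_num, Real.sq_sqrt (by norm_num), rfl⟩
  have hsq : Real.sqrt (125 * δ * τ) = q * s * r := by
    rw [← hqq, ← hs, ← hr, show q^2 * s^2 * r^2 = (q*s*r)^2 by ring]
    exact Real.sqrt_sq (by positivity)
  have hpow : δ ^ ((3:ℝ)/2) = s^3 := by
    rw [← hs, ← Real.rpow_natCast, ← Real.rpow_mul (by linarith), ← Real.rpow_natCast]
    norm_num
  rw [hsq] at hη
  have hinv : 1 / η = L * (q * s * r) := by rw [hη]; simp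
  rw [hpow, hrs]
  have hq0 : 0 < q := by linarith
  have hs0 : 0 < s := by linarith
  have hr0 : 0 < r := by linarith
  have B3 : n * (L * (4 * η * L * δ ^ 2 * D)) ≤ L * D * s^3 * r := by
    calc n * (L * (4 * η * L * δ ^ 2 * D)) ≤ τ * (L * (4 * η * L * δ ^ 2 * D)) :=
          mul_le_mul_of_nonneg_right hnT (by positivity)
      _ = (4 / q) * (L * D * s^3 * r) := by
          rw [hη, ← hs, ← hr]; field_simp
      _ ≤ 1 * (L * D * s^3 * r) := by
          apply mul_le_mul_of_nonneg_right _ (by positivity)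
          rw [div_le_one hq0]; linarith
      _ = _ := one_mul _
  have B4 : δ * (1 / η * D) ≤ 12 * (L * D * s^3 * r) := by
    rw [hinv, ← hs]
    calc _ = q * (L * D * s^3 * r) := by ring
      _ ≤ _ := mul_le_mul_of_nonneg_right hq2 (by positivity)
  have B5 : L * (δ * D) ≤ L * D * s^3 * r := by
    rw [← hs]
    calc _ = (L * D * s^2) * 1 := by ring
      _ ≤ (L * D * s^2) * (s * r) := mul_le_mul_of_nonneg_left
          (one_le_mul_of_one_le_of_one_le hs1 hr1) (by positivity)
      _ = _ := by ring
  have B6 : I ≤ 23 * (L * D * s^3 * r) := by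
    have : 0 < L * D * s^3 * r := by positivity
    linarith
  rw [← hr, div_mul_eq_mul_div, one_mul, div_le_div_iff₀ (by positivity) hr0]
  calc I * r ≤ 23 * (L * D * s^3 * r) * r := mul_le_mul_of_nonneg_right B6 hr0.le
    _ = _ := by ring
end
end

section
/- Let d ≥ 1, L > 0, α, β ≥ 0, η > 0, let X ⊆ ℝ^d be nonempty with ℓ∞-diameter at most D, let h : X → ℝ be arbitrary and let f : X → ℝ be L-Lipschitz with respect to the ℓ1 norm. Let μ_η be the product probability measure on ℝ^d whose coordinates are i.i.d. exponential with parameter η. Suppose u, v : ℝ^d → X are measurable maps such that for μ_η-almost every σ, u(σ) is an (α,β)-approximate minimizer over X of z ↦ h(z) − ⟨σ, z⟩ and v(σ) is an (α,β)-approximate minimizer over X of z ↦ h(z) + f(z) − ⟨σ, z⟩. Then for every coordinate i ∈ {1, …, d}, E_{σ∼μ_η}[ |u_i(σ) − v_i(σ)| ] ≤ (1/(9d))·E_{σ∼μ_η}[ ‖u(σ) − v(σ)‖_1 ] + (1000/9)·η L d D + E_{σ∼μ_η}[ α + β‖σ‖_1 ]/(30Ld) + (10/9)·β. -/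
open MeasureTheory

noncomputable section

lemma expo_isProb {η : ℝ} (hη : 0 < η) : IsProbabilityMeasure (expoMeasure η) := by
  constructor
  unfold expoMeasure
  rw [withDensity_apply _ MeasurableSet.univ, Measure.restrict_univ]
  have := ProbabilityTheory.lintegral_exponentialPDF_eq_one hη
  simpa only [ProbabilityTheory.exponentialPDF_eq] using this

lemma expo_meas (η : ℝ) : Measurable
    (fun x : ℝ => ENNReal.ofReal (if 0 ≤ x then η * Real.exp (-(η * x)) else 0)) := by
  apply Measurable.ennreal_ofReal
  exact Measurable.ite measurableSet_Ici (by fun_prop) measurable_const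

lemma expo_map {η c : ℝ} (hc : 0 ≤ c) :
    ENNReal.ofReal (Real.exp (-(η * c))) • (expoMeasure η).map (fun x => x + c)
      = (expoMeasure η).restrict (Set.Ici c) := by
  ext s hs
  have hm : Measurable (fun x : ℝ => x + c) := by fun_prop
  rw [Measure.smul_apply, Measure.map_apply hm hs, Measure.restrict_apply hs]
  unfold expoMeasure
  rw [withDensity_apply _ (hm hs), withDensity_apply _ (hs.inter measurableSet_Ici),
    smul_eq_mul, ← lintegral_const_mul _ (expo_meas η), ← lintegral_indicator (hm hs),
    ← lintegral_indicator (hs.inter measurableSet_Ici)]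
  rw [← lintegral_add_right_eq_self
    ((s ∩ Set.Ici c).indicator _) c]
  apply lintegral_congr
  intro x
  by_cases hxs : x + c ∈ s
  · by_cases hx : 0 ≤ x
    · have h1 : x ∈ (fun x => x + c) ⁻¹' s := hxs
      have h2 : x + c ∈ s ∩ Set.Ici c := ⟨hxs, by simpa using hx⟩
      rw [Set.indicator_of_mem h1, Set.indicator_of_mem h2, if_pos hx, if_pos (by linarith),
        ← ENNReal.ofReal_mul (Real.exp_nonneg _)]
      congr 1
      rw [mul_left_comm, ← Real.exp_add]
      congr 2
      ring
    · have h1 : x ∈ (fun x => x + c) ⁻¹' s := hxs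
      have h2 : x + c ∉ s ∩ Set.Ici c := fun hh => hx (by simpa using hh.2)
      rw [Set.indicator_of_mem h1, Set.indicator_of_notMem h2, if_neg hx]
      simp
  · have h1 : x ∉ (fun x => x + c) ⁻¹' s := hxs
    have h2 : x + c ∉ s ∩ Set.Ici c := fun hh => hxs hh.1
    rw [Set.indicator_of_notMem h1, Set.indicator_of_notMem h2]

lemma expo_integrable_id {η : ℝ} (hη : 0 < η) : Integrable (fun x : ℝ => |x|) (expoMeasure η) := by
  unfold expoMeasure
  have hlt : ∀ᵐ x : ℝ, ENNReal.ofReal (if 0 ≤ x then η * Real.exp (-(η * x)) else 0) < ⊤ :=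
    Filter.Eventually.of_forall fun x => ENNReal.ofReal_lt_top
  rw [integrable_withDensity_iff (expo_meas η) hlt]
  have h1 : IntegrableOn (fun x : ℝ => x ^ (1 : ℝ) * Real.exp (-η * x ^ (1 : ℝ))) (Set.Ioi 0) :=
    integrableOn_rpow_mul_exp_neg_mul_rpow (by norm_num) one_pos hη
  have h2 := (integrable_indicator_iff measurableSet_Ioi).mpr (h1.const_mul η)
  refine h2.congr (Filter.Eventually.of_forall fun x => ?_)
  by_cases hx : 0 < x
  · simp only
    rw [Set.indicator_of_mem (show x ∈ Set.Ioi (0:ℝ) from hx), if_pos hx.le,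
      ENNReal.toReal_ofReal (by positivity), abs_of_pos hx, Real.rpow_one]
    ring_nf
  · simp only
    rw [Set.indicator_of_notMem (show x ∉ Set.Ioi (0:ℝ) from hx)]
    rcases (not_lt.mp hx).eq_or_lt with h0 | h0
    · simp [h0]
    · rw [if_neg (not_le.mpr h0)]; simp

lemma expoProd_isProb {d : ℕ} {η : ℝ} (hη : 0 < η) : IsProbabilityMeasure (expoProd d η) := by
  have := expo_isProb hη
  unfold expoProd
  infer_instance

lemma l1_integrable {d : ℕ} {η : ℝ} (hη : 0 < η) :
    Integrable (fun σ : Fin d → ℝ => l1 σ) (expoProd d η) := by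
  have := expo_isProb hη
  unfold l1
  refine integrable_finsetSum _ fun j _ => ?_
  exact (measurePreserving_eval (fun _ : Fin d => expoMeasure η) j).integrable_comp_of_integrable
    (expo_integrable_id hη)

/-- Shift by `c` in coordinate `i`. -/
def shiftc {d : ℕ} (i : Fin d) (c : ℝ) (σ : Fin d → ℝ) : Fin d → ℝ :=
  fun j => σ j + (if j = i then c else 0)

lemma shiftc_meas {d : ℕ} (i : Fin d) (c : ℝ) : Measurable (shiftc i c) := by
  unfold shiftc
  fun_prop

lemma expoProd_map {d : ℕ} {η c : ℝ} (hη : 0 < η) (hc : 0 ≤ c) (i : Fin d) :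
    ENNReal.ofReal (Real.exp (-(η * c))) • (expoProd d η).map (shiftc i c)
      = (expoProd d η).restrict {σ | c ≤ σ i} := by
  have := expo_isProb hη
  have hset : {σ : Fin d → ℝ | c ≤ σ i} =
      Set.univ.pi (fun j => if j = i then Set.Ici c else Set.univ) := by
    ext σ
    simp only [Set.mem_ofPred_eq, Set.mem_pi, Set.mem_univ, true_implies]
    constructor
    · intro hh j
      by_cases hj : j = i
      · subst hj; simpa using hh
      · simp [hj]
    · intro hh
      simpa using hh i
  rw [hset]
  unfold expoProd
  rw [Measure.restrict_pi_pi]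
  symm
  apply Measure.pi_eq
  intro s hs
  rw [Measure.smul_apply]
  unfold shiftc
  have : ∀ j : Fin d, SigmaFinite
      ((expoMeasure η).map (fun x => x + (if j = i then c else 0))) := by
    intro j
    have : IsProbabilityMeasure ((expoMeasure η).map (fun x => x + (if j = i then c else 0))) :=
      Measure.isProbabilityMeasure_map (by fun_prop)
    infer_instance
  rw [Measure.pi_map_pi (μ := fun _ : Fin d => expoMeasure η)
    (f := fun j x => x + (if j = i then c else 0)) (fun j => by fun_prop), Measure.pi_pi]
  have key : ∀ j, ((expoMeasure η).restrict (if j = i then Set.Ici c else Set.univ)) (s j)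
      = (if j = i then ENNReal.ofReal (Real.exp (-(η * c))) else 1) *
        ((expoMeasure η).map (fun x => x + (if j = i then c else 0))) (s j) := by
    intro j
    by_cases hj : j = i
    · simp only [hj, if_true]
      rw [← expo_map hc, Measure.smul_apply, smul_eq_mul]
    · simp [hj]
  rw [Finset.prod_congr rfl fun j _ => key j, Finset.prod_mul_distrib]
  simp

lemma dotp_shiftc {d : ℕ} (i : Fin d) (c : ℝ) (σ x : Fin d → ℝ) :
    dotp (shiftc i c σ) x = dotp σ x + c * x i := by
  unfold dotp shiftc
  simp [add_mul, Finset.sum_add_distrib]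

lemma l1_shiftc {d : ℕ} (i : Fin d) {c : ℝ} (hc : 0 ≤ c) (σ : Fin d → ℝ) :
    l1 (shiftc i c σ) ≤ l1 σ + c := by
  unfold l1 shiftc
  have : ∑ j, (|σ j| + (if j = i then c else 0)) = ∑ j, |σ j| + c := by
    simp [Finset.sum_add_distrib]
  rw [← this]
  refine Finset.sum_le_sum fun j _ => ?_
  refine (abs_add_le _ _).trans ?_
  split_ifs
  · rw [abs_of_nonneg hc]
  · simp

/-- **Per-coordinate stability bound for FTPL.** With `h = ∑_{j < t} f j` and `f = f t`,
`u σ` is the FTPL prediction `x_t(σ)` and `v σ` is `x_{t+1}(σ)`; both are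
`(α,β)`-approximate minimizers of their respective perturbed cumulative losses. Then for
every coordinate `i`,
`E|uᵢ - vᵢ| ≤ (1/(9d)) E‖u - v‖₁ + (1000/9) η L d D + E[α + β‖σ‖₁]/(30Ld) + (10/9)β`. -/
theorem ftpl_per_coordinate_stability (d : ℕ) (hd : 1 ≤ d) (L α β η D : ℝ)
    (hL : 0 < L) (hα : 0 ≤ α) (hβ : 0 ≤ β) (hη : 0 < η)
    (X : Set (Fin d → ℝ)) (hX : X.Nonempty)
    (hdiam : ∀ x ∈ X, ∀ y ∈ X, ∀ i, |x i - y i| ≤ D)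
    (h f : (Fin d → ℝ) → ℝ)
    (hf : ∀ x ∈ X, ∀ y ∈ X, |f x - f y| ≤ L * l1 (x - y))
    (u v : (Fin d → ℝ) → (Fin d → ℝ))
    (humeas : Measurable u) (hvmeas : Measurable v)
    (huv : ∀ᵐ σ ∂(expoProd d η),
      (u σ ∈ X ∧ ∀ z ∈ X, h (u σ) - dotp σ (u σ) ≤ h z - dotp σ z + (α + β * l1 σ)) ∧
      (v σ ∈ X ∧ ∀ z ∈ X,
        h (v σ) + f (v σ) - dotp σ (v σ) ≤ h z + f z - dotp σ z + (α + β * l1 σ))) :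
    ∀ i : Fin d,
      (∫ σ, |u σ i - v σ i| ∂(expoProd d η)) ≤
        (1 / (9 * d)) * (∫ σ, l1 (u σ - v σ) ∂(expoProd d η)) +
          (1000 / 9) * η * L * d * D +
          (∫ σ, (α + β * l1 σ) ∂(expoProd d η)) / (30 * L * d) + (10 / 9) * β := by
  intro i
  have := expoProd_isProb (d := d) hη
  have hd0 : (0 : ℝ) < d := by exact_mod_cast hd
  obtain ⟨x0, hx0⟩ := hX
  have hD : 0 ≤ D := by simpa using hdiam x0 hx0 x0 hx0 i
  set μ := expoProd d η with hμ
  set c : ℝ := 100 * L * d with hcdef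
  have hc : 0 < c := by positivity
  set p : ℝ := Real.exp (-(η * c)) with hp
  have hp0 : 0 < p := Real.exp_pos _
  have hp1 : p ≤ 1 := Real.exp_le_one_iff.mpr (by have := mul_pos hη hc; linarith)
  have hpc : 1 - p ≤ η * c := by
    have := Real.add_one_le_exp (-(η * c)); linarith
  have hmap := expoProd_map hη hc.le i
  rw [← hμ, ← hp] at hmap
  have hT := shiftc_meas i c
  set A : Set (Fin d → ℝ) := {σ | c ≤ σ i} with hA
  have hAm : MeasurableSet A := measurableSet_le measurable_const (measurable_pi_apply i)
  have hPA : μ.real A = p := by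
    have h1 := congrArg (fun m : Measure (Fin d → ℝ) => m Set.univ) hmap
    simp only [Measure.smul_apply, Measure.restrict_apply_univ, smul_eq_mul,
      Measure.map_apply hT MeasurableSet.univ, Set.preimage_univ, measure_univ, mul_one] at h1
    rw [Measure.real, ← h1, ENNReal.toReal_ofReal hp0.le]
  have hPAc : μ.real Aᶜ = 1 - p := by
    rw [probReal_compl_eq_one_sub hAm, hPA]
  -- a.e. at the shifted point
  have hac : μ.map (shiftc i c) ≪ μ := by
    have h1 : μ.map (shiftc i c) ≪ ENNReal.ofReal p • μ.map (shiftc i c) :=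
      Measure.absolutelyContinuous_smul (by simpa using hp0)
    rw [hmap] at h1
    exact h1.trans Measure.restrict_le_self.absolutelyContinuous
  have huv' := ae_of_ae_map hT.aemeasurable (hac.ae_le huv)
  -- integrability
  have hum : ∀ j, Measurable fun σ => u σ j := fun j => (measurable_pi_apply j).comp humeas
  have hvm : ∀ j, Measurable fun σ => v σ j := fun j => (measurable_pi_apply j).comp hvmeas
  have hui : ∀ j, Integrable (fun σ => u σ j) μ := by
    intro j
    refine Integrable.of_bound (hum j).aestronglyMeasurable (|x0 j| + D) ?_
    filter_upwards [huv] with σ hσ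
    have h1 := hdiam _ hσ.1.1 _ hx0 j
    have h2 := abs_add_le (u σ j - x0 j) (x0 j)
    rw [sub_add_cancel] at h2
    rw [Real.norm_eq_abs]; linarith
  have hvi : ∀ j, Integrable (fun σ => v σ j) μ := by
    intro j
    refine Integrable.of_bound (hvm j).aestronglyMeasurable (|x0 j| + D) ?_
    filter_upwards [huv] with σ hσ
    have h1 := hdiam _ hσ.2.1 _ hx0 j
    have h2 := abs_add_le (v σ j - x0 j) (x0 j)
    rw [sub_add_cancel] at h2
    rw [Real.norm_eq_abs]; linarith
  set G : (Fin d → ℝ) → ℝ := fun σ => min (u σ i) (v σ i) with hG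
  set M : (Fin d → ℝ) → ℝ := fun σ => max (u σ i) (v σ i) with hM
  have hGi : Integrable G μ := (hui i).inf (hvi i)
  have hMi : Integrable M μ := (hui i).sup (hvi i)
  have hGm : Measurable G := (hum i).min (hvm i)
  have hNi : Integrable (fun σ => l1 (u σ - v σ)) μ := by
    unfold l1
    refine integrable_finsetSum _ fun j _ => ?_
    exact ((hui j).sub (hvi j)).abs
  have hl1 : Integrable (fun σ : Fin d → ℝ => l1 σ) μ := l1_integrable hη
  have hγi : Integrable (fun σ : Fin d → ℝ => α + β * l1 σ) μ :=
    (integrable_const α).add (hl1.const_mul β)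
  -- pointwise shifted bound
  have hpt : ∀ᵐ σ ∂μ, M σ ≤ G (shiftc i c σ) + (1 / (100 * d) * l1 (u σ - v σ)
      + (3 / c) * (α + β * l1 σ) + β) := by
    filter_upwards [huv, huv'] with σ hσ hσ'
    obtain ⟨⟨huX, hu⟩, hvX, hv⟩ := hσ
    obtain ⟨⟨huX', hu'⟩, hvX', hv'⟩ := hσ'
    set τ := shiftc i c σ with hτ
    have hdt : ∀ x, dotp τ x = dotp σ x + c * x i := dotp_shiftc i c σ
    have hlt : β * l1 τ ≤ β * l1 σ + β * c := by
      have := mul_le_mul_of_nonneg_left (l1_shiftc i hc.le σ) hβ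
      rw [mul_add] at this; exact this
    have hl0 : ∀ x : Fin d → ℝ, 0 ≤ l1 x := fun x => Finset.sum_nonneg fun _ _ => abs_nonneg _
    have hbl : 0 ≤ β * l1 σ := mul_nonneg hβ (hl0 σ)
    have hN : 0 ≤ L * l1 (u σ - v σ) := mul_nonneg hL.le (hl0 _)
    have hfl := abs_le.mp (hf _ huX _ hvX)
    have e : c * (1 / (100 * d) * l1 (u σ - v σ) + (3 / c) * (α + β * l1 σ) + β)
        = L * l1 (u σ - v σ) + 3 * (α + β * l1 σ) + β * c := by
      have : c * (1 / (100 * d)) = L := by rw [hcdef]; field_simp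
      have h3 : c * (3 / c) = 3 := by field_simp
      calc _ = (c * (1 / (100 * d))) * l1 (u σ - v σ) + (c * (3 / c)) * (α + β * l1 σ) + β * c := by
            ring
        _ = _ := by rw [this, h3]
    set R := 1 / (100 * d) * l1 (u σ - v σ) + (3 / c) * (α + β * l1 σ) + β with hR
    have a1 := hu _ huX'
    have a2 := hv _ hvX'
    have a3 := hu _ hvX
    have a4 := hv _ huX
    have b1 := hu' _ huX
    have b2 := hu' _ hvX
    have b3 := hv' _ huX
    have b4 := hv' _ hvX
    rw [hdt, hdt] at b1 b2 b3 b4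
    have k1 : u σ i ≤ u τ i + R := by
      refine le_of_mul_le_mul_left ?_ hc
      rw [mul_add, e]; linarith
    have k2 : v σ i ≤ u τ i + R := by
      refine le_of_mul_le_mul_left ?_ hc
      rw [mul_add, e]; linarith
    have k3 : u σ i ≤ v τ i + R := by
      refine le_of_mul_le_mul_left ?_ hc
      rw [mul_add, e]; linarith
    have k4 : v σ i ≤ v τ i + R := by
      refine le_of_mul_le_mul_left ?_ hc
      rw [mul_add, e]; linarith
    simp only [hM, hG]
    rw [← min_add_add_right]
    exact max_le (le_min k1 k3) (le_min k2 k4)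
  -- G is at least E M - D
  have hlow : ∀ᵐ σ ∂μ, (∫ τ, M τ ∂μ) - D ≤ G σ := by
    filter_upwards [huv] with σ hσ
    have h1 : ∫ τ, M τ ∂μ ≤ ∫ _τ, (G σ + D) ∂μ := by
      refine integral_mono_ae hMi (integrable_const _) ?_
      filter_upwards [huv] with τ hτ
      simp only [hM, hG]
      have q1 := abs_le.mp (hdiam _ hτ.1.1 _ hσ.1.1 i)
      have q2 := abs_le.mp (hdiam _ hτ.1.1 _ hσ.2.1 i)
      have q3 := abs_le.mp (hdiam _ hτ.2.1 _ hσ.1.1 i)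
      have q4 := abs_le.mp (hdiam _ hτ.2.1 _ hσ.2.1 i)
      rw [← min_add_add_right]
      exact max_le (le_min (by linarith) (by linarith)) (le_min (by linarith) (by linarith))
    rw [integral_const, probReal_univ, one_smul] at h1
    linarith
  have hsplit : ∫ σ, G σ ∂μ = (∫ σ in A, G σ ∂μ) + ∫ σ in Aᶜ, G σ ∂μ :=
    (integral_add_compl hAm hGi).symm
  have hGA : ∫ σ in A, G σ ∂μ = p * ∫ σ, G (shiftc i c σ) ∂μ := by
    rw [← hmap, integral_smul_measure, ENNReal.toReal_ofReal hp0.le, smul_eq_mul,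
      integral_map hT.aemeasurable hGm.aestronglyMeasurable]
  have hGAc : (1 - p) * ((∫ τ, M τ ∂μ) - D) ≤ ∫ σ in Aᶜ, G σ ∂μ := by
    have h1 : ∫ _σ in Aᶜ, ((∫ τ, M τ ∂μ) - D) ∂μ ≤ ∫ σ in Aᶜ, G σ ∂μ :=
      integral_mono_ae (integrable_const _) hGi.integrableOn (ae_restrict_of_ae hlow)
    rw [setIntegral_const, hPAc, smul_eq_mul] at h1
    exact h1
  have hGTi : Integrable (fun σ => G (shiftc i c σ)) μ := by
    have h1 : Integrable G (ENNReal.ofReal p • μ.map (shiftc i c)) := by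
      rw [hmap]; exact hGi.integrableOn
    rw [integrable_smul_measure (by simpa using hp0) ENNReal.ofReal_ne_top] at h1
    exact h1.comp_measurable hT
  set N := ∫ σ, l1 (u σ - v σ) ∂μ with hNdef
  set Γ := ∫ σ, (α + β * l1 σ) ∂μ with hΓdef
  have hN0 : 0 ≤ N := integral_nonneg fun σ => Finset.sum_nonneg fun _ _ => abs_nonneg _
  have hΓ0 : 0 ≤ Γ := integral_nonneg fun σ =>
    add_nonneg hα (mul_nonneg hβ (Finset.sum_nonneg fun _ _ => abs_nonneg _))
  have i1 := hNi.const_mul (1 / (100 * (d : ℝ)))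
  have i2 := hγi.const_mul (3 / c)
  have i12 : Integrable (fun σ => 1 / (100 * (d : ℝ)) * l1 (u σ - v σ)
      + (3 / c) * (α + β * l1 σ)) μ := i1.add i2
  have i123 : Integrable (fun σ => 1 / (100 * (d : ℝ)) * l1 (u σ - v σ)
      + (3 / c) * (α + β * l1 σ) + β) μ := i12.add (integrable_const β)
  have hMint : ∫ σ, M σ ∂μ ≤ (∫ σ, G (shiftc i c σ) ∂μ)
      + (1 / (100 * d) * N + 3 / c * Γ + β) := by
    have h1 := integral_mono_ae hMi
      (hGTi.add i123) hpt
    have h2 : ∫ σ, (G (shiftc i c σ) + (1 / (100 * d) * l1 (u σ - v σ)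
      + (3 / c) * (α + β * l1 σ) + β)) ∂μ = (∫ σ, G (shiftc i c σ) ∂μ)
      + (1 / (100 * d) * N + 3 / c * Γ + β) := by
      rw [integral_add hGTi i123,
        integral_add i12 (integrable_const β), integral_add i1 i2,
        integral_const_mul, integral_const_mul, integral_const, probReal_univ, one_smul]
    rw [← h2]; exact h1
  have habs : ∫ σ, |u σ i - v σ i| ∂μ = (∫ σ, M σ ∂μ) - ∫ σ, G σ ∂μ := by
    rw [← integral_sub hMi hGi]
    refine integral_congr_ae (Filter.Eventually.of_forall fun σ => ?_)
    simp only [hM, hG]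
    exact (max_sub_min_eq_abs' _ _).symm
  set R := 1 / (100 * d) * N + 3 / c * Γ + β with hR
  have hR0 : 0 ≤ R := by positivity
  have hfin : ∫ σ, |u σ i - v σ i| ∂μ ≤ η * c * D + R := by
    rw [habs, hsplit, hGA]
    have h1 := mul_le_mul_of_nonneg_left hMint hp0.le
    have h2 := mul_le_mul_of_nonneg_right hpc hD
    have h3 := mul_le_mul_of_nonneg_right hp1 hR0
    linarith
  refine hfin.trans ?_
  have e1 : 1 / (100 * (d : ℝ)) * N ≤ 1 / (9 * d) * N := by
    gcongr; norm_num
  have e2 : 3 / c * Γ ≤ Γ / (30 * L * d) := by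
    have : Γ / (30 * L * d) = (10 / 3) / c * Γ := by rw [hcdef]; field_simp; ring
    rw [this]
    gcongr; norm_num
  have e3 : η * c * D ≤ 1000 / 9 * η * L * d * D := by
    have : 0 ≤ η * L * d * D := by positivity
    rw [hcdef]; linarith
  linarith
end
end
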